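/- Let H be a finite dimensional Hopf π-coalgebra over a field k. Then there exists a unique π-grouplike element g = (g_α)_{α∈π} of H such that (id_{H_α} ⊗ λ_β) ∘ Δ_{α,β} = λ_{αβ}(·)g_α for every right π-integral λ = (λ_α)_{α∈π} for H and all α, β ∈ π. -/

import Mathlib

open scoped TensorProduct

noncomputable section

/-- Transport of the algebra structure along an equality of group indices. -/
def gcast (k : Type*) [CommSemiring k] {π : Type*} (H : π → Type*)
    [∀ α, Ring (H α)] [∀ α, Algebra k (H α)] {a b : π} (h : a = b) :
    H a ≃ₐ[k] H b := by subst h; exact AlgEquiv.refl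

/-- Transport of a module family along an equality of group indices. -/
def fcast (k : Type*) [CommSemiring k] {π : Type*} (M : π → Type*)
    [∀ α, AddCommGroup (M α)] [∀ α, Module k (M α)] {a b : π} (h : a = b) :
    M a ≃ₗ[k] M b := by subst h; exact LinearEquiv.refl k (M a)

/-- A Hopf `π`-coalgebra (in the sense of Turaev/Virelizier) over a field `k`:
a family of `k`-algebras `H α` with comultiplication `Δ`, counit `ε` and antipode `S`. -/
class HopfGCoalgebra (k : Type*) [Field k] {π : Type*} [Group π]
    (H : π → Type*) [∀ α, Ring (H α)] [∀ α, Algebra k (H α)] where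
  Δ : ∀ α β : π, H (α * β) →ₐ[k] H α ⊗[k] H β
  ε : H (1 : π) →ₐ[k] k
  S : ∀ α : π, H α →ₗ[k] H α⁻¹
  coassoc : ∀ α β γ : π,
    (TensorProduct.assoc k (H α) (H β) (H γ)).toLinearMap ∘ₗ
        (TensorProduct.map (Δ α β).toLinearMap (LinearMap.id : H γ →ₗ[k] H γ)) ∘ₗ
        (Δ (α * β) γ).toLinearMap
      = (TensorProduct.map (LinearMap.id : H α →ₗ[k] H α) (Δ β γ).toLinearMap) ∘ₗ
        (Δ α (β * γ)).toLinearMap ∘ₗ (gcast k H (mul_assoc α β γ)).toLinearMap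
  counit_right : ∀ α : π,
    (TensorProduct.rid k (H α)).toLinearMap ∘ₗ
        (TensorProduct.map (LinearMap.id : H α →ₗ[k] H α) ε.toLinearMap) ∘ₗ
        (Δ α 1).toLinearMap ∘ₗ (gcast k H (mul_one α).symm).toLinearMap = LinearMap.id
  counit_left : ∀ α : π,
    (TensorProduct.lid k (H α)).toLinearMap ∘ₗ
        (TensorProduct.map ε.toLinearMap (LinearMap.id : H α →ₗ[k] H α)) ∘ₗ
        (Δ 1 α).toLinearMap ∘ₗ (gcast k H (one_mul α).symm).toLinearMap = LinearMap.id
  antipode_left : ∀ α : π,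
    (LinearMap.mul' k (H α)) ∘ₗ
        (TensorProduct.map ((gcast k H (inv_inv α)).toLinearMap ∘ₗ S α⁻¹)
          (LinearMap.id : H α →ₗ[k] H α)) ∘ₗ (Δ α⁻¹ α).toLinearMap
      = (Algebra.linearMap k (H α)) ∘ₗ ε.toLinearMap ∘ₗ
        (gcast k H (inv_mul_cancel α)).toLinearMap
  antipode_right : ∀ α : π,
    (LinearMap.mul' k (H α)) ∘ₗ
        (TensorProduct.map (LinearMap.id : H α →ₗ[k] H α)
          ((gcast k H (inv_inv α)).toLinearMap ∘ₗ S α⁻¹)) ∘ₗ (Δ α α⁻¹).toLinearMap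
      = (Algebra.linearMap k (H α)) ∘ₗ ε.toLinearMap ∘ₗ
        (gcast k H (mul_inv_cancel α)).toLinearMap

namespace HopfGCoalgebra

variable (k : Type*) [Field k] {π : Type*} [Group π] (H : π → Type*)
  [∀ α, Ring (H α)] [∀ α, Algebra k (H α)] [HopfGCoalgebra k H]

/-- A left `π`-integral for `H`. -/
def IsLeftIntegral (lam : ∀ α : π, H α →ₗ[k] k) : Prop :=
  ∀ (α β : π) (x : H (α * β)),
    (TensorProduct.rid k (H α))
        (TensorProduct.map (LinearMap.id : H α →ₗ[k] H α) (lam β) (Δ α β x))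
      = lam (α * β) x • (1 : H α)

/-- A right `π`-integral for `H`. -/
def IsRightIntegral (lam : ∀ α : π, H α →ₗ[k] k) : Prop :=
  ∀ (α β : π) (x : H (α * β)),
    (TensorProduct.lid k (H β))
        (TensorProduct.map (lam α) (LinearMap.id : H β →ₗ[k] H β) (Δ α β x))
      = lam (α * β) x • (1 : H β)

/-- A `π`-grouplike element of `H`. -/
def IsGrouplike (g : ∀ α : π, H α) : Prop :=
  (∀ α β : π, Δ α β (g (α * β)) = g α ⊗ₜ[k] g β) ∧ ε (k := k) (H := H) (g 1) = 1

/-- `g` is the distinguished `π`-grouplike element of `H`. -/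
def IsDistinguishedGrouplike (g : ∀ α : π, H α) : Prop :=
  IsGrouplike k H g ∧
    ∀ lam : ∀ α : π, H α →ₗ[k] k, IsRightIntegral k H lam →
      ∀ (α β : π) (x : H (α * β)),
        (TensorProduct.rid k (H α))
            (TensorProduct.map (LinearMap.id : H α →ₗ[k] H α) (lam β) (Δ α β x))
          = lam (α * β) x • g α

/-- `ν` is the distinguished grouplike element of `H₁*`. -/
def IsDistinguishedNu (ν : H (1 : π) →ₐ[k] k) : Prop :=
  ∀ Λ : H (1 : π), (∀ x : H (1 : π), x * Λ = ε (k := k) (H := H) x • Λ) →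
    ∀ x : H (1 : π), Λ * x = ν x • Λ

/-- The right action `a ↼ f` of `f ∈ H₁*` on `a ∈ H α`. -/
def hitR (f : H (1 : π) →ₗ[k] k) {α : π} (a : H α) : H α :=
  (TensorProduct.lid k (H α))
    (TensorProduct.map f (LinearMap.id : H α →ₗ[k] H α)
      (Δ 1 α ((gcast k H (one_mul α).symm) a)))

/-- The left action `f ⇀ a` of `f ∈ H₁*` on `a ∈ H α`. -/
def hitL (f : H (1 : π) →ₗ[k] k) {α : π} (a : H α) : H α :=
  (TensorProduct.rid k (H α))
    (TensorProduct.map (LinearMap.id : H α →ₗ[k] H α) f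
      (Δ α 1 ((gcast k H (mul_one α).symm) a)))


/-- The comultiplication, with all arguments explicit. -/
def comul (α β : π) : H (α * β) →ₐ[k] H α ⊗[k] H β := Δ α β

/-- The counit, with all arguments explicit. -/
def counit : H (1 : π) →ₐ[k] k := ε

/-- The antipode, with all arguments explicit. -/
def antipode (α : π) : H α →ₗ[k] H α⁻¹ := S α

end HopfGCoalgebra

open HopfGCoalgebra
/-- A right Hopf `π`-comodule over `H`. -/
class HopfGComodule (k : Type*) [Field k] {π : Type*} [Group π]
    (H : π → Type*) [∀ α, Ring (H α)] [∀ α, Algebra k (H α)] [HopfGCoalgebra k H]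
    (M : π → Type*) [∀ α, AddCommGroup (M α)] [∀ α, Module k (M α)] where
  ρ : ∀ α β : π, M (α * β) →ₗ[k] M α ⊗[k] H β
  ρ_coassoc : ∀ α β γ : π,
    (TensorProduct.assoc k (M α) (H β) (H γ)).toLinearMap ∘ₗ
        (TensorProduct.map (ρ α β) (LinearMap.id : H γ →ₗ[k] H γ)) ∘ₗ (ρ (α * β) γ)
      = (TensorProduct.map (LinearMap.id : M α →ₗ[k] M α) (Δ β γ).toLinearMap) ∘ₗ
        (ρ α (β * γ)) ∘ₗ (fcast k M (mul_assoc α β γ)).toLinearMap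
  ρ_counit : ∀ α : π,
    (TensorProduct.rid k (M α)).toLinearMap ∘ₗ
        (TensorProduct.map (LinearMap.id : M α →ₗ[k] M α)
          (ε (k := k) (H := H)).toLinearMap) ∘ₗ
        (ρ α 1) ∘ₗ (fcast k M (mul_one α).symm).toLinearMap = LinearMap.id
  act : ∀ α : π, M α →ₗ[k] H α →ₗ[k] M α
  act_one : ∀ (α : π) (m : M α), act α m 1 = m
  act_mul : ∀ (α : π) (m : M α) (a b : H α), act α (act α m a) b = act α m (a * b)
  ρ_act : ∀ (α β : π) (m : M (α * β)) (a : H (α * β)),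
    ρ α β (act (α * β) m a)
      = TensorProduct.map (TensorProduct.lift (act α)) (LinearMap.mul' k (H β))
          ((TensorProduct.tensorTensorTensorComm k (M α) (H β) (H α) (H β))
            (ρ α β m ⊗ₜ[k] (Δ α β a)))

namespace HopfGComodule

variable (k : Type*) [Field k] {π : Type*} [Group π] (H : π → Type*)
  [∀ α, Ring (H α)] [∀ α, Algebra k (H α)] [HopfGCoalgebra k H]
  (M : π → Type*) [∀ α, AddCommGroup (M α)] [∀ α, Module k (M α)] [HopfGComodule k H M]

/-- The submodule of coinvariant families of `H` on `M`. -/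
def coinvFam : Submodule k (∀ α, M α) where
  carrier := {m | ∀ α β : π, ρ (H := H) α β (m (α * β)) = m α ⊗ₜ[k] (1 : H β)}
  add_mem' := by
    intro a b ha hb α β
    simp only [Pi.add_apply, map_add, ha α β, hb α β, TensorProduct.add_tmul]
  zero_mem' := by
    intro α β
    simp only [Pi.zero_apply, map_zero, TensorProduct.zero_tmul]
  smul_mem' := by
    intro c a ha α β
    simp only [Pi.smul_apply, map_smul, ha α β, TensorProduct.smul_tmul']

/-- The `α`-component of the `π`-subcomodule of coinvariants. -/
def coinvSub (α : π) : Submodule k (M α) :=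
  (coinvFam k H M).map (LinearMap.proj α : (∀ γ, M γ) →ₗ[k] M α)


/-- The comodule structure maps, with all arguments explicit. -/
def coact (α β : π) : M (α * β) →ₗ[k] M α ⊗[k] H β := ρ α β

/-- The right `H α`-action on `M α`, with all arguments explicit. -/
def hact (α : π) : M α →ₗ[k] H α →ₗ[k] M α := act α

end HopfGComodule

section Cosemisimple

variable (k : Type*) [Field k] {π : Type*} [Group π] (H : π → Type*)
  [∀ α, Ring (H α)] [∀ α, Algebra k (H α)]
  (M : π → Type*) [∀ α, AddCommGroup (M α)] [∀ α, Module k (M α)]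

/-- `N` is a `π`-subcomodule of the right `π`-comodule `(M, ρ)` over `H`. -/
def IsGSubcomodule (ρ : ∀ α β : π, M (α * β) →ₗ[k] M α ⊗[k] H β)
    (N : ∀ α, Submodule k (M α)) : Prop :=
  ∀ (α β : π), ∀ x ∈ N (α * β),
    ρ α β x ∈ LinearMap.range
      (TensorProduct.map (N α).subtype (LinearMap.id : H β →ₗ[k] H β))

/-- `N` is a simple `π`-subcomodule of `(M, ρ)`. -/
def IsSimpleGSubcomodule (ρ : ∀ α β : π, M (α * β) →ₗ[k] M α ⊗[k] H β)
    (N : ∀ α, Submodule k (M α)) : Prop :=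
  IsGSubcomodule k H M ρ N ∧ (∃ α, N α ≠ ⊥) ∧
    ∀ P : ∀ α, Submodule k (M α), IsGSubcomodule k H M ρ P → (∀ α, P α ≤ N α) →
      (∀ α, P α = ⊥) ∨ P = N

/-- The right `π`-comodule `(M, ρ)` is cosemisimple: it is the sum of its simple
`π`-subcomodules. -/
def IsGCosemisimple (ρ : ∀ α β : π, M (α * β) →ₗ[k] M α ⊗[k] H β) : Prop :=
  ∀ α : π,
    (⨆ N : {N : ∀ γ, Submodule k (M γ) // IsSimpleGSubcomodule k H M ρ N}, N.1 α) = ⊤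

end Cosemisimple

section CoalgCosemisimple

variable (k : Type*) [Field k] (C : Type*) [AddCommGroup C] [Module k C]

/-- `N` is a subcomodule of the coalgebra `(C, δ)` viewed as a right comodule over itself. -/
def IsSubcoideal (δ : C →ₗ[k] C ⊗[k] C) (N : Submodule k C) : Prop :=
  ∀ x ∈ N, δ x ∈ LinearMap.range (TensorProduct.map N.subtype (LinearMap.id : C →ₗ[k] C))

def IsSimpleSubcoideal (δ : C →ₗ[k] C ⊗[k] C) (N : Submodule k C) : Prop :=
  IsSubcoideal k C δ N ∧ N ≠ ⊥ ∧
    ∀ P : Submodule k C, IsSubcoideal k C δ P → P ≤ N → P = ⊥ ∨ P = N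

/-- The coalgebra `(C, δ)` is cosemisimple. -/
def IsCosemisimpleCoalgebra (δ : C →ₗ[k] C ⊗[k] C) : Prop :=
  (⨆ N : {N : Submodule k C // IsSimpleSubcoideal k C δ N}, N.1) = ⊤

end CoalgCosemisimple
/-- A crossed Hopf `π`-coalgebra: a Hopf `π`-coalgebra with a crossing `φ`. -/
class CrossedHopfGCoalgebra (k : Type*) [Field k] {π : Type*} [Group π]
    (H : π → Type*) [∀ α, Ring (H α)] [∀ α, Algebra k (H α)]
    extends HopfGCoalgebra k H where
  φ : ∀ β α : π, H α ≃ₐ[k] H (β * α * β⁻¹)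
  φ_comul : ∀ β α γ : π,
    (TensorProduct.map (φ β α).toLinearMap (φ β γ).toLinearMap) ∘ₗ (Δ α γ).toLinearMap
      = (Δ (β * α * β⁻¹) (β * γ * β⁻¹)).toLinearMap ∘ₗ
        (gcast k H (show β * (α * γ) * β⁻¹ = (β * α * β⁻¹) * (β * γ * β⁻¹) by
          group)).toLinearMap ∘ₗ (φ β (α * γ)).toLinearMap
  φ_counit : ∀ (β : π) (x : H (1 : π)),
    ε ((gcast k H (show β * 1 * β⁻¹ = (1 : π) by group)) (φ β 1 x)) = ε x
  φ_mul : ∀ (β β' α : π) (x : H α),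
    (gcast k H (show β * (β' * α * β'⁻¹) * β⁻¹ = (β * β') * α * (β * β')⁻¹ by group))
        (φ β (β' * α * β'⁻¹) (φ β' α x))
      = φ (β * β') α x


namespace CrossedHopfGCoalgebra

variable (k : Type*) [Field k] {π : Type*} [Group π] (H : π → Type*)
  [∀ α, Ring (H α)] [∀ α, Algebra k (H α)] [CrossedHopfGCoalgebra k H]

/-- The crossing, with all arguments explicit. -/
def crossing (β α : π) : H α ≃ₐ[k] H (β * α * β⁻¹) := φ β α

end CrossedHopfGCoalgebra

open CrossedHopfGCoalgebra

/-- A quasitriangular Hopf `π`-coalgebra: a crossed Hopf `π`-coalgebra with an R-matrix. -/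
class QTHopfGCoalgebra (k : Type*) [Field k] {π : Type*} [Group π]
    (H : π → Type*) [∀ α, Ring (H α)] [∀ α, Algebra k (H α)]
    extends CrossedHopfGCoalgebra k H where
  Rm : ∀ α β : π, H α ⊗[k] H β
  Rm_isUnit : ∀ α β : π, IsUnit (Rm α β)
  Rm_comul : ∀ (α β : π) (x : H (α * β)),
    Rm α β * Δ α β x
      = (TensorProduct.comm k (H β) (H α))
          ((TensorProduct.map
              ((gcast k H (show α⁻¹ * (α * β * α⁻¹) * α⁻¹⁻¹ = β by group)).toLinearMap ∘ₗ
                (φ α⁻¹ (α * β * α⁻¹)).toLinearMap)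
              (LinearMap.id : H α →ₗ[k] H α))
            ((Δ (α * β * α⁻¹) α)
              ((gcast k H (show α * β = (α * β * α⁻¹) * α by group)) x))) * Rm α β
  Rm_delta_right : ∀ α β γ : π,
    TensorProduct.map (LinearMap.id : H α →ₗ[k] H α) (Δ β γ).toLinearMap (Rm α (β * γ))
      = (TensorProduct.map (LinearMap.id : H α →ₗ[k] H α)
            (TensorProduct.mk k (H β) (H γ) 1) (Rm α γ))
        * (TensorProduct.map (LinearMap.id : H α →ₗ[k] H α)
            ((TensorProduct.mk k (H β) (H γ)).flip 1) (Rm α β))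
  Rm_delta_left : ∀ α β γ : π,
    (TensorProduct.assoc k (H α) (H β) (H γ))
        (TensorProduct.map (Δ α β).toLinearMap (LinearMap.id : H γ →ₗ[k] H γ)
          (Rm (α * β) γ))
      = (TensorProduct.map (LinearMap.id : H α →ₗ[k] H α)
            (TensorProduct.mk k (H β) (H γ) 1)
            (TensorProduct.map (LinearMap.id : H α →ₗ[k] H α)
              ((gcast k H (show β⁻¹ * (β * γ * β⁻¹) * β⁻¹⁻¹ = γ by group)).toLinearMap ∘ₗ
                (φ β⁻¹ (β * γ * β⁻¹)).toLinearMap)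
              (Rm α (β * γ * β⁻¹))))
        * (TensorProduct.mk k (H α) (H β ⊗[k] H γ) 1 (Rm β γ))
  Rm_phi : ∀ β α γ : π,
    TensorProduct.map (φ β α).toLinearMap (φ β γ).toLinearMap (Rm α γ)
      = Rm (β * α * β⁻¹) (β * γ * β⁻¹)

namespace QTHopfGCoalgebra

variable (k : Type*) [Field k] {π : Type*} [Group π] (H : π → Type*)
  [∀ α, Ring (H α)] [∀ α, Algebra k (H α)] [QTHopfGCoalgebra k H]

/-- The square of the antipode `S_{α⁻¹} ∘ S_α : H α → H α`. -/
def antipodeSq (α : π) : H α →ₗ[k] H α :=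
  (gcast k H (inv_inv α)).toLinearMap ∘ₗ S α⁻¹ ∘ₗ S α

/-- The map `S_{α⁻¹} ∘ φ_α : H (α⁻¹) → H α`. -/
def sphi (α : π) : H α⁻¹ →ₗ[k] H α :=
  (gcast k H (inv_inv α)).toLinearMap ∘ₗ S α⁻¹ ∘ₗ
    (gcast k H (show α * α⁻¹ * α⁻¹ = α⁻¹ by group)).toLinearMap ∘ₗ
    (φ α α⁻¹).toLinearMap

/-- The Drinfeld element `u_α = m_α ∘ (S_{α⁻¹}φ_α ⊗ id) ∘ σ_{α,α⁻¹} (R_{α,α⁻¹})`. -/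
def drinfeld (α : π) : H α :=
  LinearMap.mul' k (H α)
    (TensorProduct.map (sphi k H α) (LinearMap.id : H α →ₗ[k] H α)
      ((TensorProduct.comm k (H α) (H α⁻¹)) (Rm α α⁻¹)))

/-- The element `S_{α⁻¹}(u_{α⁻¹}) ∈ H α`. -/
def sdrinfeld (α : π) : H α :=
  (gcast k H (inv_inv α)) (S (k := k) (H := H) α⁻¹ (drinfeld k H α⁻¹))

/-- The `π`-grouplike element `ℓ_α = S_{α⁻¹}(u_{α⁻¹})⁻¹ u_α`. -/
def ell (α : π) : H α :=
  Ring.inverse (sdrinfeld k H α) * drinfeld k H α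


/-- The R-matrix, with all arguments explicit. -/
def rmatrix (α β : π) : H α ⊗[k] H β := Rm α β

end QTHopfGCoalgebra

open QTHopfGCoalgebra

namespace HopfGCoalgebra

open TensorProduct

theorem gcast_gcast_symm {k : Type*} [Field k] {π : Type*} {H : π → Type*}
    [∀ α, Ring (H α)] [∀ α, Algebra k (H α)] {a b : π} (h : a = b) (x : H b) :
    gcast k H h (gcast k H h.symm x) = x := by
  subst h
  rfl

theorem sum_rid_coord_tmul {k V W ι : Type*} [Field k] [AddCommGroup V] [Module k V]
    [AddCommGroup W] [Module k W] [Fintype ι] (B : Module.Basis ι k W) (t : V ⊗[k] W) :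
    ∑ i, TensorProduct.rid k V (map LinearMap.id (B.coord i) t) ⊗ₜ[k] B i = t := by
  induction t with
  | zero => simp
  | add x y hx hy => simp only [map_add, add_tmul, Finset.sum_add_distrib, hx, hy]
  | tmul x y =>
    simp only [map_tmul, LinearMap.id_apply, rid_tmul, smul_tmul, ← tmul_sum]
    congr 1
    exact B.sum_repr y

section Slices

variable (k : Type*) [Field k] {π : Type*} [Group π] (H : π → Type*)
  [∀ α, Ring (H α)] [∀ α, Algebra k (H α)] [HopfGCoalgebra k H]

/-- The comultiplication `H c → H a ⊗ H b` for any factorisation `a * b = c`. -/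
def comulOf {a b c : π} (h : a * b = c) : H c →ₐ[k] H a ⊗[k] H b :=
  (Δ a b).comp (gcast k H h.symm).toAlgHom

/-- The antipode `H a → H b` for any `b` inverse to `a`. -/
def antipodeOf {a b : π} (h : a * b = 1) : H a →ₗ[k] H b :=
  (gcast k H (inv_eq_of_mul_eq_one_right h)).toLinearMap ∘ₗ S a

/-- The counit as a linear form. -/
def counitₗ : H (1 : π) →ₗ[k] k := (counit k H).toLinearMap

variable {k H}

theorem counitₗ_one : counitₗ k H 1 = 1 := map_one (counit k H)

theorem counitₗ_mul (x y : H (1 : π)) :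
    counitₗ k H (x * y) = counitₗ k H x * counitₗ k H y := map_mul (counit k H) x y

theorem comulOf_coassoc {a b c ab bc abc : π} (hab : a * b = ab) (habc : ab * c = abc)
    (hbc : b * c = bc) (h : a * bc = abc) (x : H abc) :
    TensorProduct.assoc k (H a) (H b) (H c)
        (map (comulOf k H hab).toLinearMap LinearMap.id (comulOf k H habc x))
      = map LinearMap.id (comulOf k H hbc).toLinearMap (comulOf k H h x) := by
  subst hab hbc habc
  exact LinearMap.congr_fun (coassoc (k := k) (H := H) a b c) x

theorem comulOf_counit_right (a : π) (x : H a) :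
    TensorProduct.rid k (H a)
      (map LinearMap.id (counitₗ k H) (comulOf k H (mul_one a) x)) = x :=
  LinearMap.congr_fun (counit_right (k := k) (H := H) a) x

theorem comulOf_counit_left (a : π) (x : H a) :
    TensorProduct.lid k (H a)
      (map (counitₗ k H) LinearMap.id (comulOf k H (one_mul a) x)) = x :=
  LinearMap.congr_fun (counit_left (k := k) (H := H) a) x

theorem antipodeOf_left {a b : π} (h : a * b = 1) (x : H 1) :
    LinearMap.mul' k (H b) (map (antipodeOf k H h) LinearMap.id (comulOf k H h x))
      = counitₗ k H x • 1 := by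
  obtain rfl := eq_inv_of_mul_eq_one_left h
  have := LinearMap.congr_fun (antipode_left (k := k) (H := H) b)
    (gcast k H (inv_mul_cancel b).symm x)
  rw [← Algebra.algebraMap_eq_smul_one]
  exact this.trans (congrArg (fun y => algebraMap k (H b) (counitₗ k H y))
    (gcast_gcast_symm _ x))

theorem antipodeOf_right {a b : π} (h : a * b = 1) (h' : b * a = 1) (x : H 1) :
    LinearMap.mul' k (H b) (map LinearMap.id (antipodeOf k H h) (comulOf k H h' x))
      = counitₗ k H x • 1 := by
  obtain rfl := eq_inv_of_mul_eq_one_left h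
  have := LinearMap.congr_fun (antipode_right (k := k) (H := H) b)
    (gcast k H (mul_inv_cancel b).symm x)
  rw [← Algebra.algebraMap_eq_smul_one]
  exact this.trans (congrArg (fun y => algebraMap k (H b) (counitₗ k H y))
    (gcast_gcast_symm _ x))

theorem antipodeOf_one {a b : π} (h : a * b = 1) : antipodeOf k H h 1 = 1 := by
  have := antipodeOf_left (k := k) (H := H) h 1
  simpa [Algebra.TensorProduct.one_def, counitₗ_one] using this

variable (k H) in
/-- The square of the antipode of `H a`. -/
def sqAntipode {a b : π} (h : a * b = 1) : H a →ₗ[k] H a :=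
  antipodeOf k H (mul_eq_one_comm.mp h) ∘ₗ antipodeOf k H h

theorem sqAntipode_congr {a b c : π} (h : a * b = 1) (h' : a * c = 1) :
    sqAntipode k H h = sqAntipode k H h' := by
  obtain rfl : b = c := mul_left_cancel (h.trans h'.symm)
  rfl

variable [∀ α, FiniteDimensional k (H α)]

variable (k H) in
/-- A chosen basis of `H a`. -/
abbrev stdBasis (a : π) : Module.Basis (Fin (Module.finrank k (H a))) k (H a) :=
  Module.finBasis k (H a)

variable (k H) in
/-- The coefficient in `H a` of the `i`-th basis vector of `H b` in the comultiplication. -/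
def slice {a b c : π} (h : a * b = c) (i : Fin (Module.finrank k (H b))) : H c →ₗ[k] H a :=
  (TensorProduct.rid k (H a)).toLinearMap ∘ₗ
    map LinearMap.id ((stdBasis k H b).coord i) ∘ₗ (comulOf k H h).toLinearMap

theorem comulOf_eq_sum {a b c : π} (h : a * b = c) (x : H c) :
    comulOf k H h x = ∑ i, slice k H h i x ⊗ₜ[k] stdBasis k H b i :=
  (sum_rid_coord_tmul (stdBasis k H b) _).symm

theorem sum_counit_smul_basis (a : π) (x : H a) :
    ∑ i, counitₗ k H (slice k H (one_mul a) i x) • stdBasis k H a i = x := by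
  simpa [comulOf_eq_sum] using comulOf_counit_left (k := k) a x

theorem sum_counit_smul_slice (a : π) (x : H a) :
    ∑ i, counitₗ k H (stdBasis k H 1 i) • slice k H (mul_one a) i x = x := by
  simpa [comulOf_eq_sum] using comulOf_counit_right (k := k) a x

theorem sum_antipode_mul {a b : π} (h : a * b = 1) (x : H 1) :
    ∑ i, antipodeOf k H h (slice k H h i x) * stdBasis k H b i = counitₗ k H x • 1 := by
  simpa [comulOf_eq_sum] using antipodeOf_left (k := k) h x

theorem sum_mul_antipode {a b : π} (h : a * b = 1) (hba : b * a = 1) (x : H 1) :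
    ∑ i, slice k H hba i x * antipodeOf k H h (stdBasis k H a i) = counitₗ k H x • 1 := by
  simpa [comulOf_eq_sum] using antipodeOf_right (k := k) h hba x

/-- `x₁ ⊗ S(x₂) x₃ = x ⊗ 1`. -/
theorem sum_tmul_antipode_mul {a b b' c : π} (h₁ : c * b = a) (h₂ : a * b' = c)
    (hb : b' * b = 1) (x : H a) :
    ∑ i, ∑ j, slice k H h₂ j (slice k H h₁ i x) ⊗ₜ[k]
      (antipodeOf k H hb (stdBasis k H b' j) * stdBasis k H b i) = x ⊗ₜ[k] 1 := by
  have h := congrArg (map LinearMap.id (LinearMap.mul' k (H b) ∘ₗ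
    map (antipodeOf k H hb) LinearMap.id)) (comulOf_coassoc h₂ h₁ hb (mul_one a) x)
  simp only [comulOf_eq_sum h₁, comulOf_eq_sum (mul_one a), map_sum, map_tmul,
    AlgHom.toLinearMap_apply, LinearMap.comp_apply, LinearMap.id_apply, antipodeOf_left,
    comulOf_eq_sum h₂, sum_tmul, assoc_tmul, LinearMap.mul'_apply] at h
  rw [h]
  simp only [← smul_tmul, ← sum_tmul, sum_counit_smul_slice]

/-- `x₁ ⊗ x₂ S(x₃) = x ⊗ 1`. -/
theorem sum_tmul_mul_antipode {a b b' c : π} (h₁ : c * b = a) (h₂ : a * b' = c)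
    (hb : b * b' = 1) (x : H a) :
    ∑ i, ∑ j, slice k H h₂ j (slice k H h₁ i x) ⊗ₜ[k]
      (stdBasis k H b' j * antipodeOf k H hb (stdBasis k H b i)) = x ⊗ₜ[k] 1 := by
  have hb' : b' * b = 1 := mul_eq_one_comm.mp hb
  have h := congrArg (map LinearMap.id (LinearMap.mul' k (H b') ∘ₗ
    map LinearMap.id (antipodeOf k H hb))) (comulOf_coassoc h₂ h₁ hb' (mul_one a) x)
  simp only [comulOf_eq_sum h₁, comulOf_eq_sum (mul_one a), map_sum, map_tmul,
    AlgHom.toLinearMap_apply, LinearMap.comp_apply, LinearMap.id_apply, antipodeOf_right hb hb',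
    comulOf_eq_sum h₂, sum_tmul, assoc_tmul, LinearMap.mul'_apply] at h
  rw [h]
  simp only [← smul_tmul, ← sum_tmul, sum_counit_smul_slice]

/-- Coassociativity in terms of slices. -/
theorem sum_slice_slice_tmul {a b c ab bc abc : π} (hab : a * b = ab) (habc : ab * c = abc)
    (hbc : b * c = bc) (h : a * bc = abc) (x : H abc) :
    ∑ i, ∑ j, slice k H hab j (slice k H habc i x) ⊗ₜ[k]
        (stdBasis k H b j ⊗ₜ[k] stdBasis k H c i)
      = ∑ i, slice k H h i x ⊗ₜ[k] comulOf k H hbc (stdBasis k H bc i) := by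
  have := comulOf_coassoc (k := k) hab habc hbc h x
  simpa only [comulOf_eq_sum habc, comulOf_eq_sum h, map_sum, map_tmul,
    AlgHom.toLinearMap_apply, LinearMap.id_apply, comulOf_eq_sum hab, sum_tmul,
    assoc_tmul] using this

/-- Convolution on the right by an algebra morphism `j` is undone by convolution by `j ∘ S`. -/
theorem eq_sum_mul_antipode {A : Type*} [Ring A] [Algebra k A] {a b b' c : π} (h : a * b = c)
    (h' : c * b' = a) (hb : b' * b = 1) (P : H a →ₗ[k] A) (Q : H c →ₗ[k] A) (j : H b →ₐ[k] A)
    (hPQ : ∀ x, ∑ i, P (slice k H h i x) * j (stdBasis k H b i) = Q x) (x : H a) :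
    P x = ∑ i, Q (slice k H h' i x) * j (antipodeOf k H hb (stdBasis k H b' i)) := by
  have := congrArg (LinearMap.mul' k A ∘ₗ map P j.toLinearMap)
    (sum_tmul_mul_antipode (k := k) h' h hb x)
  simp only [map_sum, LinearMap.comp_apply, map_tmul, LinearMap.mul'_apply,
    AlgHom.toLinearMap_apply, map_mul, ← mul_assoc, ← Finset.sum_mul, hPQ, map_one,
    mul_one] at this
  exact this.symm

theorem sum_antipodeOf_mul_mul {a b : π} (h : a * b = 1) (p : H 1) (y : H a) :
    ∑ i, antipodeOf k H h (slice k H h i p * y) * stdBasis k H b i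
      = counitₗ k H p • antipodeOf k H h y := by
  have := eq_sum_mul_antipode h (one_mul a) h
    (∑ i, LinearMap.mulRight k (stdBasis k H b i) ∘ₗ antipodeOf k H h ∘ₗ
      LinearMap.mulLeft k (slice k H h i p))
    (counitₗ k H p • (counitₗ k H).smulRight 1) (AlgHom.id k (H b)) (fun z => by
      have := antipodeOf_left (k := k) (H := H) h (p * z)
      rw [map_mul, comulOf_eq_sum h p, comulOf_eq_sum h z, Finset.sum_mul_sum,
        Finset.sum_comm] at this
      simpa [Finset.sum_mul, mul_assoc, counitₗ_mul, mul_smul] using this) y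
  simp only [LinearMap.sum_apply, LinearMap.comp_apply, LinearMap.mulRight_apply,
    LinearMap.mulLeft_apply] at this
  rw [this]
  simp only [LinearMap.smul_apply, LinearMap.smulRight_apply, AlgHom.id_apply,
    smul_mul_assoc, one_mul, ← map_smul, ← map_sum, ← Finset.smul_sum, sum_counit_smul_basis]

theorem antipodeOf_mul {a b : π} (h : a * b = 1) (x y : H a) :
    antipodeOf k H h (x * y) = antipodeOf k H h y * antipodeOf k H h x := by
  have := eq_sum_mul_antipode h (one_mul a) h
    (antipodeOf k H h ∘ₗ LinearMap.mulRight k y)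
    ((counitₗ k H).smulRight (antipodeOf k H h y)) (AlgHom.id k (H b))
    (fun z => by simpa using sum_antipodeOf_mul_mul h z y) x
  simp only [LinearMap.comp_apply, LinearMap.mulRight_apply, LinearMap.smulRight_apply,
    AlgHom.id_apply, smul_mul_assoc] at this
  rw [this]
  simp only [← mul_smul_comm, ← Finset.mul_sum, ← map_smul, ← map_sum, sum_counit_smul_basis]

theorem counitₗ_antipodeOf (x : H (1 : π)) :
    counitₗ k H (antipodeOf k H (one_mul 1) x) = counitₗ k H x := by
  have := congrArg (counitₗ k H) (sum_antipode_mul (k := k) (one_mul 1) x)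
  simp only [map_sum, counitₗ_mul, map_smul, counitₗ_one, smul_eq_mul, mul_one] at this
  rw [← this]
  conv_lhs => rw [← sum_counit_smul_slice (k := k) 1 x]
  simp only [map_sum, map_smul, smul_eq_mul, mul_comm]

theorem comulOf_antipodeOf {a b c a' b' c' : π} (hab : a * b = c) (ha : a * a' = 1)
    (hb : b * b' = 1) (hc : c * c' = 1) (hc' : b' * a' = c') (x : H c) :
    comulOf k H hc' (antipodeOf k H hc x)
      = TensorProduct.comm k (H a') (H b')
          (map (antipodeOf k H ha) (antipodeOf k H hb) (comulOf k H hab x)) := by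
  have hcb : c * b' = a := by rw [← hab, mul_assoc, hb, mul_one]
  let P : H c →ₗ[k] H b' ⊗[k] H a' := (comulOf k H hc').toLinearMap ∘ₗ antipodeOf k H hc
  let P₁ : H a →ₗ[k] H b' ⊗[k] H a' :=
    ∑ i, LinearMap.mulRight k (stdBasis k H b' i ⊗ₜ[k] 1) ∘ₗ P ∘ₗ slice k H hcb i
  have hP₁ (z : H a) : P₁ z = 1 ⊗ₜ[k] antipodeOf k H ha z := by
    have := eq_sum_mul_antipode ha (one_mul a) ha P₁ ((counitₗ k H).smulRight 1)
      (Algebra.TensorProduct.includeRight : H a' →ₐ[k] H b' ⊗[k] H a') (fun w => by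
        have key := congrArg (LinearMap.mul' k (H b' ⊗[k] H a') ∘ₗ map P LinearMap.id)
          (sum_slice_slice_tmul hcb ha hc' hc w)
        have hl := congrArg (comulOf k H hc') (sum_antipode_mul (k := k) hc w)
        simp only [map_sum, map_mul, map_smul, map_one] at hl
        simp only [map_sum, LinearMap.comp_apply, map_tmul, LinearMap.mul'_apply,
          LinearMap.id_apply] at key
        rw [LinearMap.smulRight_apply, ← hl]
        refine Eq.trans ?_ key
        simp [P₁, LinearMap.sum_apply, Finset.sum_mul, mul_assoc]) z
    rw [this]
    simp only [LinearMap.smulRight_apply, smul_mul_assoc, one_mul,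
      Algebra.TensorProduct.includeRight_apply, ← tmul_smul, ← tmul_sum, ← map_smul, ← map_sum,
      sum_counit_smul_basis]
  have := eq_sum_mul_antipode hcb hab hb P P₁
    (Algebra.TensorProduct.includeLeft : H b' →ₐ[k] H b' ⊗[k] H a')
    (fun z => by simp [P₁, LinearMap.sum_apply]) x
  rw [comulOf_eq_sum hab]
  simpa [hP₁, P] using this

theorem sum_antipode_tmul_mul_comulOf (x : H (1 : π)) :
    ∑ i, (antipodeOf k H (one_mul 1) (slice k H (one_mul 1) i x) ⊗ₜ[k] (1 : H (1 : π))) *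
      comulOf k H (one_mul 1) (stdBasis k H 1 i) = 1 ⊗ₜ[k] x := by
  have := congrArg (LinearMap.mul' k (H 1 ⊗[k] H 1) ∘ₗ
    map ((TensorProduct.mk k (H (1 : π)) (H (1 : π))).flip 1 ∘ₗ antipodeOf k H (one_mul 1))
      LinearMap.id)
    (sum_slice_slice_tmul (k := k) (one_mul 1) (one_mul 1) (one_mul 1) (one_mul 1) x)
  simp only [map_sum, LinearMap.comp_apply, map_tmul, LinearMap.mul'_apply, LinearMap.id_apply,
    LinearMap.flip_apply, mk_apply, Algebra.TensorProduct.tmul_mul_tmul, one_mul, ← sum_tmul,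
    sum_antipode_mul, smul_tmul, ← tmul_sum, sum_counit_smul_basis] at this
  exact this.symm

theorem sqAntipode_mul {a b : π} (h : a * b = 1) (x y : H a) :
    sqAntipode k H h (x * y) = sqAntipode k H h x * sqAntipode k H h y := by
  simp [sqAntipode, antipodeOf_mul]

theorem comulOf_sqAntipode {a b c a' b' c' : π} (hab : a * b = c) (ha : a * a' = 1)
    (hb : b * b' = 1) (hc : c * c' = 1) (x : H c) :
    comulOf k H hab (sqAntipode k H hc x)
      = map (sqAntipode k H ha) (sqAntipode k H hb) (comulOf k H hab x) := by
  have hc' : b' * a' = c' := by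
    rw [← inv_eq_of_mul_eq_one_right ha, ← inv_eq_of_mul_eq_one_right hb,
      ← inv_eq_of_mul_eq_one_right hc, ← hab, mul_inv_rev]
  rw [sqAntipode, LinearMap.comp_apply,
    comulOf_antipodeOf hc' (mul_eq_one_comm.mp hb) (mul_eq_one_comm.mp ha) _ hab,
    comulOf_antipodeOf hab ha hb hc hc']
  generalize comulOf k H hab x = t
  induction t with
  | zero => simp
  | add x y hx hy => simp only [map_add, hx, hy]
  | tmul x y => rfl

/-- `Δ(S²(y₁)) (1 ⊗ S(y₂)) = S²(y) ⊗ 1`, the second legs being multiplied in reverse order. -/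
theorem sum_antipode_mul_comulOf_sqAntipode {a b b' c a' c' : π} (h₁ : c * b' = a)
    (h₂ : a * b = c) (ha : a * a' = 1) (hb : b' * b = 1) (hc : c * c' = 1) (y : H a) :
    ∑ j, (1 ⊗ₜ[k] antipodeOf k H hb (stdBasis k H b' j)) *
      comulOf k H h₂ (sqAntipode k H hc (slice k H h₁ j y)) = sqAntipode k H ha y ⊗ₜ[k] 1 := by
  have hb' : b * b' = 1 := mul_eq_one_comm.mp hb
  have := congrArg (map (sqAntipode k H ha) (antipodeOf k H hb))
    (sum_tmul_antipode_mul h₁ h₂ hb' y)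
  simp only [map_sum, map_tmul, antipodeOf_one, antipodeOf_mul] at this
  rw [← this]
  refine Finset.sum_congr rfl fun j _ => ?_
  rw [comulOf_sqAntipode h₂ ha hb' hc, comulOf_eq_sum h₂]
  simp [Finset.mul_sum, sqAntipode]

end Slices

section Integral

variable {k : Type*} [Field k] {π : Type*} [Group π] {H : π → Type*}
  [∀ α, Ring (H α)] [∀ α, Algebra k (H α)] [HopfGCoalgebra k H]

/-- The operator `y ↦ f(y₁) y₂` on `H a`. -/
def dualAct (f : H (1 : π) →ₗ[k] k) (a : π) : H a →ₗ[k] H a :=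
  (TensorProduct.lid k (H a)).toLinearMap ∘ₗ map f LinearMap.id ∘ₗ
    (comulOf k H (one_mul a)).toLinearMap

/-- The operator `y ↦ f(y₁) S²(y₂) x` on `H a`. -/
def integralOp (f : H (1 : π) →ₗ[k] k) (a : π) (x : H a) : H a →ₗ[k] H a :=
  LinearMap.mulRight k x ∘ₗ sqAntipode k H (mul_inv_cancel a) ∘ₗ dualAct f a

theorem integralOp_apply (f : H (1 : π) →ₗ[k] k) (a : π) (x y : H a) :
    integralOp f a x y = sqAntipode k H (mul_inv_cancel a) (dualAct f a y) * x := rfl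

theorem integralOp_one_apply (f : H (1 : π) →ₗ[k] k) (x y : H (1 : π)) :
    integralOp f 1 x y = sqAntipode k H (one_mul 1) (dualAct f 1 y) * x := by
  rw [integralOp_apply, sqAntipode_congr]

theorem IsRightIntegral.comulOf_eq {lam : ∀ a : π, H a →ₗ[k] k} (hlam : IsRightIntegral k H lam)
    {a b c : π} (h : a * b = c) (x : H c) :
    TensorProduct.lid k (H b) (map (lam a) LinearMap.id (comulOf k H h x)) = lam c x • 1 := by
  subst h
  exact hlam a b x

variable [∀ α, FiniteDimensional k (H α)]

theorem dualAct_apply (f : H (1 : π) →ₗ[k] k) (a : π) (y : H a) :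
    dualAct f a y = ∑ i, f (slice k H (one_mul a) i y) • stdBasis k H a i := by
  simp [dualAct, comulOf_eq_sum]

theorem slice_dualAct (f : H (1 : π) →ₗ[k] k) {a b c : π} (h : c * b = a) (y : H a)
    (j : Fin (Module.finrank k (H b))) :
    slice k H h j (dualAct f a y) = dualAct f c (slice k H h j y) := by
  have hc := congrArg ((TensorProduct.lid k (H c ⊗[k] H b)).toLinearMap ∘ₗ map f LinearMap.id)
    (comulOf_coassoc (one_mul c) h h (one_mul a) y)
  have hl : comulOf k H h (dualAct f a y)
      = map (dualAct f c) LinearMap.id (comulOf k H h y) := by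
    refine Eq.trans ?_ (hc.symm.trans ?_)
    · rw [comulOf_eq_sum (one_mul a), dualAct_apply]
      simp
    · rw [comulOf_eq_sum h]
      simp [comulOf_eq_sum (one_mul c), dualAct_apply, sum_tmul, smul_tmul']
  have := congrArg (TensorProduct.rid k (H c)) (congrArg
    (map LinearMap.id ((stdBasis k H b).coord j)) hl)
  refine this.trans ?_
  simp only [slice, LinearMap.comp_apply, AlgHom.toLinearMap_apply]
  generalize comulOf k H h y = t
  induction t with
  | zero => simp
  | add x y hx hy => simp only [map_add, hx, hy]
  | tmul x y => simp

/-- The trace of `y ↦ f(y₁) S²(y₂) x`, a right integral in `x` for every `f`. -/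
def traceIntegral (a : π) : (H (1 : π) →ₗ[k] k) →ₗ[k] H a →ₗ[k] k :=
  LinearMap.mk₂ k (fun f x => LinearMap.trace k (H a) (integralOp f a x))
    (fun f g x => by
      rw [← map_add]; congr 1; ext y
      simp [integralOp_apply, dualAct_apply, add_smul, Finset.sum_add_distrib, add_mul])
    (fun c f x => by
      rw [← map_smul]; congr 1; ext y
      simp [integralOp_apply, dualAct_apply, mul_smul, ← Finset.smul_sum])
    (fun f x y => by
      rw [← map_add]; congr 1; ext z
      simp [integralOp_apply, mul_add])
    (fun c f x => by
      rw [← map_smul]; congr 1; ext y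
      simp [integralOp_apply])

theorem traceIntegral_apply (a : π) (f : H (1 : π) →ₗ[k] k) (x : H a) :
    traceIntegral a f x = LinearMap.trace k (H a) (integralOp f a x) := rfl

theorem sum_smul_trace_integralOp (f : H (1 : π) →ₗ[k] k) {a b c : π} (h : a * b = c)
    (g : H b →ₗ[k] k) (x : H c) :
    ∑ l, g (stdBasis k H b l) • traceIntegral a f (slice k H h l x)
      = g 1 • traceIntegral c f x := by
  have h' : c * b⁻¹ = a := by rw [← h, mul_inv_cancel_right]
  let G (V : Type _) [AddCommGroup V] [Module k V] : V ⊗[k] H b →ₗ[k] V :=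
    (TensorProduct.rid k V).toLinearMap ∘ₗ map LinearMap.id g
  have hG {d : π} (v : H d) (w : H b) : G (H d) (v ⊗ₜ w) = g w • v := by simp [G]
  let u (j) (i) : k := g (antipodeOf k H (inv_mul_cancel b) (stdBasis k H b⁻¹ j) *
    stdBasis k H b i)
  have h₁ : ∑ l, g (stdBasis k H b l) • integralOp f a (slice k H h l x)
      = ∑ j, ∑ i, u j i • (slice k H h i ∘ₗ (integralOp f c x ∘ₗ slice k H h' j)) := by
    ext y
    have := congrArg (fun t => G (H a) (t * comulOf k H h x))
      (sum_antipode_mul_comulOf_sqAntipode h' h (mul_inv_cancel a) (inv_mul_cancel b)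
        (mul_inv_cancel c) (dualAct f a y))
    simp only [Finset.sum_mul, mul_assoc, ← map_mul, map_sum] at this
    rw [comulOf_eq_sum h x, Finset.mul_sum] at this
    simp only [comulOf_eq_sum h, Finset.mul_sum, Algebra.TensorProduct.tmul_mul_tmul, one_mul,
      map_sum, hG, slice_dualAct] at this
    simp only [LinearMap.sum_apply, LinearMap.smul_apply, LinearMap.comp_apply,
      integralOp_apply]
    exact this.symm
  have h₂ : ∑ j, ∑ i, u j i • ((integralOp f c x ∘ₗ slice k H h' j) ∘ₗ slice k H h i)
      = g 1 • integralOp f c x := by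
    ext y
    have := congrArg (fun t => integralOp f c x (G (H c) t))
      (sum_tmul_antipode_mul h h' (inv_mul_cancel b) y)
    simp only [map_sum, hG, map_smul] at this
    rw [Finset.sum_comm]
    simpa only [LinearMap.sum_apply, LinearMap.smul_apply, LinearMap.comp_apply] using this
  simp only [traceIntegral_apply, ← map_smul, ← map_sum]
  rw [h₁, ← h₂]
  simp only [map_sum, map_smul, LinearMap.trace_comp_comm' (slice k H h _)]

theorem isRightIntegral_traceIntegral (f : H (1 : π) →ₗ[k] k) :
    IsRightIntegral k H (fun a => traceIntegral a f) := by
  intro a b x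
  rw [← sub_eq_zero, ← Module.forall_dual_apply_eq_zero_iff k]
  intro g
  have := sum_smul_trace_integralOp f (rfl : a * b = a * b) g x
  rw [map_sub, sub_eq_zero, map_smul, smul_eq_mul]
  refine Eq.trans ?_ (this.trans (mul_comm _ _))
  change g (TensorProduct.lid k (H b) (map (traceIntegral a f) LinearMap.id
    (comulOf k H (rfl : a * b = a * b) x))) = _
  rw [comulOf_eq_sum]
  simp [mul_comm]

/-- `f(a y₁) S²(y₂) = S(a₂) S²((a₁ y)₂) f((a₁ y)₁)` in the Hopf algebra `H 1`. -/
theorem sqAntipode_dualAct_comp_mulLeft (f : H (1 : π) →ₗ[k] k) (a y : H (1 : π)) :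
    sqAntipode k H (one_mul 1) (dualAct (f ∘ₗ LinearMap.mulLeft k a) 1 y)
      = ∑ j, antipodeOf k H (one_mul 1) (stdBasis k H 1 j) *
          sqAntipode k H (one_mul 1) (dualAct f 1 (slice k H (one_mul 1) j a * y)) := by
  have hd (z : H (1 : π)) : dualAct f 1 (z * y) = ∑ i, ∑ l,
      f (slice k H (one_mul 1) i z * slice k H (one_mul 1) l y) •
        (stdBasis k H 1 i * stdBasis k H 1 l) := by
    simp only [dualAct, LinearMap.comp_apply, AlgHom.toLinearMap_apply, map_mul]
    simp [comulOf_eq_sum, Finset.sum_mul_sum]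
  let Φ (l) : H (1 : π) ⊗[k] H (1 : π) →ₗ[k] H (1 : π) :=
    LinearMap.mulRight k (sqAntipode k H (one_mul 1) (stdBasis k H 1 l)) ∘ₗ
      antipodeOf k H (one_mul 1) ∘ₗ (TensorProduct.lid k (H (1 : π))).toLinearMap ∘ₗ
        map (f ∘ₗ LinearMap.mulRight k (slice k H (one_mul 1) l y)) LinearMap.id
  have hΦ (l) (p q : H (1 : π)) : Φ l (p ⊗ₜ q) = f (p * slice k H (one_mul 1) l y) •
      (antipodeOf k H (one_mul 1) q * sqAntipode k H (one_mul 1) (stdBasis k H 1 l)) := by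
    simp [Φ]
  let Ψ : H (1 : π) ⊗[k] H (1 : π) →ₗ[k] H (1 : π) := ∑ l, Φ l
  have hΨ (p q : H (1 : π)) : Ψ (p ⊗ₜ q) = ∑ l, f (p * slice k H (one_mul 1) l y) •
      (antipodeOf k H (one_mul 1) q * sqAntipode k H (one_mul 1) (stdBasis k H 1 l)) := by
    simp only [Ψ, LinearMap.sum_apply, hΦ]
  have := congrArg Ψ
    (sum_tmul_antipode_mul (k := k) (one_mul 1) (one_mul 1) (one_mul 1) a)
  simp only [map_sum, hΨ, antipodeOf_one, one_mul, antipodeOf_mul] at this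
  simp only [dualAct_apply (f ∘ₗ LinearMap.mulLeft k a), hd, map_sum, map_smul, sqAntipode_mul,
    LinearMap.comp_apply, LinearMap.mulLeft_apply, Finset.mul_sum, mul_smul_comm, ← mul_assoc]
  exact this.symm

theorem traceIntegral_comp_mulLeft (f : H (1 : π) →ₗ[k] k) (a x : H (1 : π)) :
    traceIntegral 1 (f ∘ₗ LinearMap.mulLeft k a) x = counitₗ k H a • traceIntegral 1 f x := by
  have h₁ : integralOp (f ∘ₗ LinearMap.mulLeft k a) 1 x
      = ∑ j, LinearMap.mulLeft k (antipodeOf k H (one_mul 1) (stdBasis k H 1 j)) ∘ₗ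
          (integralOp f 1 x ∘ₗ LinearMap.mulLeft k (slice k H (one_mul 1) j a)) := by
    ext y
    simp [integralOp_one_apply, sqAntipode_dualAct_comp_mulLeft, Finset.sum_mul, mul_assoc]
  have h₂ : ∑ j, (integralOp f 1 x ∘ₗ LinearMap.mulLeft k (slice k H (one_mul 1) j a)) ∘ₗ
        LinearMap.mulLeft k (antipodeOf k H (one_mul 1) (stdBasis k H 1 j))
      = counitₗ k H a • integralOp f 1 x := by
    ext y
    have := congrArg (fun z => integralOp f 1 x (z * y))
      (sum_mul_antipode (k := k) (one_mul 1) (one_mul 1) a)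
    simpa [Finset.sum_mul, mul_assoc] using this
  rw [traceIntegral_apply, traceIntegral_apply, ← map_smul, h₁, ← h₂]
  simp only [map_sum, LinearMap.trace_comp_comm' (LinearMap.mulLeft k _) (integralOp f 1 x ∘ₗ _)]

theorem exists_traceIntegral_ne_zero :
    ∃ (f : H (1 : π) →ₗ[k] k) (x : H (1 : π)), traceIntegral 1 f x ≠ 0 := by
  by_contra! h
  have hop : ∑ j, integralOp ((stdBasis k H 1).coord j) 1
      (antipodeOf k H (one_mul 1) (stdBasis k H 1 j))
      = (counitₗ k H).smulRight (1 : H (1 : π)) := by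
    ext y
    have := congrArg (antipodeOf k H (one_mul 1))
      (sum_mul_antipode (k := k) (one_mul 1) (one_mul 1) y)
    simp only [map_sum, antipodeOf_mul, map_smul, antipodeOf_one] at this
    rw [LinearMap.smulRight_apply, ← this]
    simp only [LinearMap.sum_apply, integralOp_one_apply, dualAct_apply, map_sum, map_smul,
      Finset.sum_mul, smul_mul_assoc]
    rw [Finset.sum_comm]
    refine Finset.sum_congr rfl fun i _ => ?_
    have hs : antipodeOf k H (one_mul 1) (slice k H (one_mul 1) i y)
        = ∑ j, (stdBasis k H 1).repr (slice k H (one_mul 1) i y) j •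
            antipodeOf k H (one_mul 1) (stdBasis k H 1 j) := by
      conv_lhs => rw [← (stdBasis k H 1).sum_repr (slice k H (one_mul 1) i y)]
      simp only [map_sum, map_smul]
    rw [hs, Finset.mul_sum]
    exact Finset.sum_congr rfl fun j _ => (mul_smul_comm _ _ _).symm
  have := congrArg (LinearMap.trace k (H (1 : π))) hop
  simp only [map_sum, ← traceIntegral_apply, h, Finset.sum_const_zero,
    LinearMap.trace_smulRight, counitₗ_one] at this
  exact zero_ne_one this

variable (k H) in
/-- There are a left integral `Λ` of the Hopf algebra `H 1` and a right `π`-integral `lam` with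
`lam Λ = 1`. -/
theorem exists_integrals :
    ∃ (Λ : H (1 : π)) (lam : ∀ a, H a →ₗ[k] k), (∀ a, a * Λ = counitₗ k H a • Λ) ∧
      IsRightIntegral k H lam ∧ lam 1 Λ = 1 := by
  obtain ⟨f, x, hf⟩ := exists_traceIntegral_ne_zero (k := k) (H := H)
  let Λ : H (1 : π) := (Module.evalEquiv k (H 1)).symm ((traceIntegral 1).flip x)
  have hΛ (g : H (1 : π) →ₗ[k] k) : g Λ = traceIntegral 1 g x :=
    Module.apply_evalEquiv_symm_apply k (H 1) g _
  have hint (a : H (1 : π)) : a * Λ = counitₗ k H a • Λ := by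
    rw [← sub_eq_zero, ← Module.forall_dual_apply_eq_zero_iff k]
    intro g
    rw [map_sub, sub_eq_zero, map_smul, hΛ, ← traceIntegral_comp_mulLeft, ← hΛ]
    rfl
  have hop (g : H (1 : π) →ₗ[k] k) : integralOp g 1 Λ = g.smulRight Λ := by
    ext y
    simp only [integralOp_one_apply, hint, sqAntipode, LinearMap.comp_apply,
      counitₗ_antipodeOf, LinearMap.smulRight_apply]
    congr 1
    conv_rhs => rw [← sum_counit_smul_slice (k := k) 1 y]
    simp [dualAct_apply, mul_comm]
  have htr (g : H (1 : π) →ₗ[k] k) : traceIntegral 1 g Λ = g Λ := by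
    rw [traceIntegral_apply, hop, LinearMap.trace_smulRight]
  have hne : f Λ ≠ 0 := by rwa [hΛ]
  refine ⟨(f Λ)⁻¹ • Λ, fun a => traceIntegral a f, fun a => ?_,
    isRightIntegral_traceIntegral f, ?_⟩
  · rw [mul_smul_comm, hint, smul_comm]
  · rw [map_smul, htr, smul_eq_mul, inv_mul_cancel₀ hne]

/-- In the Hopf algebra `H 1`, `lam(S(x) Λ₁) Λ₂ = lam(Λ) x`. -/
theorem IsRightIntegral.dualAct_comp_mulLeft {lam : ∀ a : π, H a →ₗ[k] k}
    (hlam : IsRightIntegral k H lam) {Λ : H (1 : π)}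
    (hΛ : ∀ a, a * Λ = counitₗ k H a • Λ) (x : H (1 : π)) :
    dualAct (lam 1 ∘ₗ LinearMap.mulLeft k (antipodeOf k H (one_mul 1) x)) 1 Λ
      = lam 1 Λ • x := by
  have h₁ : (antipodeOf k H (one_mul 1) x ⊗ₜ[k] (1 : H (1 : π))) * comulOf k H (one_mul 1) Λ
      = (1 ⊗ₜ[k] x) * comulOf k H (one_mul 1) Λ := by
    have hi (i) : (antipodeOf k H (one_mul 1) (slice k H (one_mul 1) i x) ⊗ₜ[k] (1 : H (1 : π))) *
          comulOf k H (one_mul 1) (stdBasis k H 1 i) * comulOf k H (one_mul 1) Λ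
        = (antipodeOf k H (one_mul 1) (counitₗ k H (stdBasis k H 1 i) •
            slice k H (one_mul 1) i x) ⊗ₜ[k] (1 : H (1 : π))) * comulOf k H (one_mul 1) Λ := by
      rw [mul_assoc, ← map_mul, hΛ, map_smul, mul_smul_comm, map_smul, ← smul_tmul',
        smul_mul_assoc]
    rw [← sum_antipode_tmul_mul_comulOf, Finset.sum_mul]
    simp only [hi, ← Finset.sum_mul, ← sum_tmul, ← map_sum]
    rw [sum_counit_smul_slice]
  have h₂ := congrArg (fun t => TensorProduct.lid k (H (1 : π)) (map (lam 1) LinearMap.id t)) h₁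
  have h₃ := congrArg (x * ·) (hlam.comulOf_eq (one_mul 1) Λ)
  rw [comulOf_eq_sum] at h₂ h₃
  simp only [Finset.mul_sum, Algebra.TensorProduct.tmul_mul_tmul, one_mul, map_sum, map_tmul,
    LinearMap.id_apply, lid_tmul, mul_smul_comm, mul_one] at h₂ h₃
  rw [← h₃, ← h₂, dualAct_apply]
  rfl

/-- A right `π`-integral vanishing at a nondegenerate left integral of `H 1` is zero. -/
theorem IsRightIntegral.eq_zero {Λ : H (1 : π)} {lam rho : ∀ a : π, H a →ₗ[k] k}
    (hΛ : ∀ a, a * Λ = counitₗ k H a • Λ) (hlam : IsRightIntegral k H lam)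
    (hone : lam 1 Λ = 1) (hrho : IsRightIntegral k H rho) (hzero : rho 1 Λ = 0) (a : π) :
    rho a = 0 := by
  let Ψ : Module.Dual k (H (1 : π)) →ₗ[k] H (1 : π) :=
    { toFun := fun f => dualAct f 1 Λ
      map_add' := fun f g => by simp [dualAct_apply, add_smul, Finset.sum_add_distrib]
      map_smul' := fun c f => by simp [dualAct_apply, mul_smul, Finset.smul_sum] }
  have hsurj : Function.Surjective Ψ := fun x =>
    ⟨_, (hlam.dualAct_comp_mulLeft hΛ x).trans (by rw [hone, one_smul])⟩
  have hinj := (LinearMap.injective_iff_surjective_of_finrank_eq_finrank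
    Subspace.dual_finrank_eq).mpr hsurj
  have h₁ : rho 1 = 0 := by
    refine hinj ?_
    rw [map_zero]
    exact (hrho.comulOf_eq (one_mul 1) Λ).trans (by rw [hzero, zero_smul])
  ext x
  have h := hrho.comulOf_eq (one_mul a) x
  rw [h₁, map_zero_left, LinearMap.zero_apply, map_zero] at h
  rcases smul_eq_zero.mp h.symm with h | h
  · exact h
  · rw [← mul_one x, h, mul_zero, map_zero, map_zero]

theorem IsRightIntegral.eq_smul {Λ : H (1 : π)} {lam rho : ∀ a : π, H a →ₗ[k] k}
    (hΛ : ∀ a, a * Λ = counitₗ k H a • Λ) (hlam : IsRightIntegral k H lam)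
    (hone : lam 1 Λ = 1) (hrho : IsRightIntegral k H rho) (a : π) :
    rho a = rho 1 Λ • lam a := by
  refine sub_eq_zero.mp (IsRightIntegral.eq_zero (rho := fun a => rho a - rho 1 Λ • lam a)
    hΛ hlam hone (fun a b x => ?_) (by simp [hone]) a)
  have h₁ := hrho a b x
  have h₂ := hlam a b x
  have h₃ : map (rho a - rho 1 Λ • lam a) (LinearMap.id : H b →ₗ[k] H b)
      = map (rho a) LinearMap.id - rho 1 Λ • map (lam a) LinearMap.id :=
    TensorProduct.ext' fun y z => by simp [sub_tmul, smul_tmul']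
  change TensorProduct.lid k (H b) (map (rho a - rho 1 Λ • lam a) LinearMap.id (Δ a b x))
    = (rho (a * b) - rho 1 Λ • lam (a * b)) x • (1 : H b)
  simp only [h₃, LinearMap.sub_apply, LinearMap.smul_apply, map_sub, map_smul, h₁, h₂, sub_smul,
    smul_assoc]

/-- The convolution `f * lam` of a linear form `f` on `H a` with a right `π`-integral `lam`
is a right `π`-integral. -/
theorem IsRightIntegral.conv {lam : ∀ a : π, H a →ₗ[k] k} (hlam : IsRightIntegral k H lam)
    {a : π} (f : H a →ₗ[k] k) :
    IsRightIntegral k H fun c => f ∘ₗ (TensorProduct.rid k (H a)).toLinearMap ∘ₗ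
      map LinearMap.id (lam (a⁻¹ * c)) ∘ₗ
        (comulOf k H (mul_inv_cancel_left a c)).toLinearMap := by
  intro c d x
  let Φ : H a ⊗[k] (H (a⁻¹ * c) ⊗[k] H d) →ₗ[k] H d :=
    (TensorProduct.lid k (H d)).toLinearMap ∘ₗ
      map f ((TensorProduct.lid k (H d)).toLinearMap ∘ₗ map (lam (a⁻¹ * c)) LinearMap.id)
  have := congrArg Φ (sum_slice_slice_tmul (k := k) (mul_inv_cancel_left a c)
    (rfl : c * d = c * d) (mul_assoc a⁻¹ c d) (mul_inv_cancel_left a (c * d)) x)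
  simp only [Φ, map_sum, LinearMap.comp_apply, map_tmul, LinearEquiv.coe_coe, lid_tmul,
    hlam.comulOf_eq, LinearMap.id_apply] at this
  change TensorProduct.lid k (H d) (map _ LinearMap.id
    (comulOf k H (rfl : c * d = c * d) x)) = _
  have hc (c : π) (z : H c) : (f ∘ₗ (TensorProduct.rid k (H a)).toLinearMap ∘ₗ
      map LinearMap.id (lam (a⁻¹ * c)) ∘ₗ
        (comulOf k H (mul_inv_cancel_left a c)).toLinearMap) z
      = ∑ j, f (slice k H (mul_inv_cancel_left a c) j z) *
          lam (a⁻¹ * c) (stdBasis k H (a⁻¹ * c) j) := by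
    simp [comulOf_eq_sum, mul_comm]
  rw [comulOf_eq_sum]
  simp only [hc, Finset.sum_smul, mul_smul, map_sum, map_tmul, lid_tmul, LinearMap.id_apply]
  exact this

theorem exists_distinguished {Λ : H (1 : π)} {lam : ∀ a : π, H a →ₗ[k] k}
    (hΛ : ∀ a, a * Λ = counitₗ k H a • Λ) (hlam : IsRightIntegral k H lam)
    (hone : lam 1 Λ = 1) :
    ∃ g : ∀ a : π, H a, ∀ {a b c : π} (h : a * b = c) (x : H c),
      TensorProduct.rid k (H a) (map LinearMap.id (lam b) (comulOf k H h x))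
        = lam c x • g a := by
  refine ⟨fun a => TensorProduct.rid k (H a) (map LinearMap.id (lam (a⁻¹ * 1))
    (comulOf k H (mul_inv_cancel_left a 1) Λ)), fun {a b c} h x => ?_⟩
  obtain rfl := eq_inv_mul_of_mul_eq h
  rw [← sub_eq_zero, ← Module.forall_dual_apply_eq_zero_iff k]
  intro f
  rw [map_sub, sub_eq_zero, map_smul, smul_eq_mul, mul_comm]
  exact LinearMap.congr_fun (IsRightIntegral.eq_smul hΛ hlam hone (hlam.conv f) c) x

theorem IsDistinguishedGrouplike.of_integrals {Λ : H (1 : π)} {lam : ∀ a : π, H a →ₗ[k] k}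
    (hΛ : ∀ a, a * Λ = counitₗ k H a • Λ) (hlam : IsRightIntegral k H lam)
    (hone : lam 1 Λ = 1) {g : ∀ a : π, H a}
    (hg : ∀ {a b c : π} (h : a * b = c) (x : H c),
      TensorProduct.rid k (H a) (map LinearMap.id (lam b) (comulOf k H h x)) = lam c x • g a) :
    IsDistinguishedGrouplike k H g := by
  have hgΛ {a b : π} (h : a * b = 1) :
      ∑ i, lam b (stdBasis k H b i) • slice k H h i Λ = g a := by
    have := hg h Λ
    rw [hone, one_smul, comulOf_eq_sum] at this
    simpa only [map_sum, map_tmul, rid_tmul, LinearMap.id_apply] using this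
  refine ⟨⟨fun a b => ?_, ?_⟩, fun rho hrho a b x => ?_⟩
  · have h := mul_inv_cancel (a * b)
    have h' : a * (b * (a * b)⁻¹) = 1 := by rw [← mul_assoc, h]
    let Φ : H a ⊗[k] (H b ⊗[k] H (a * b)⁻¹) →ₗ[k] H a ⊗[k] H b :=
      map LinearMap.id ((TensorProduct.rid k (H b)).toLinearMap ∘ₗ
        map LinearMap.id (lam (a * b)⁻¹))
    have := congrArg Φ (comulOf_coassoc (k := k) (rfl : a * b = a * b) h rfl h' Λ)
    rw [comulOf_eq_sum h, comulOf_eq_sum h'] at this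
    have hΦ (t : H a ⊗[k] H b) (z : H (a * b)⁻¹) :
        Φ (TensorProduct.assoc k _ _ _ (t ⊗ₜ z)) = lam (a * b)⁻¹ z • t := by
      induction t with
      | zero => simp
      | add p q hp hq => simp only [add_tmul, map_add, hp, hq, smul_add]
      | tmul p q => simp [Φ]
    simp only [map_sum, map_tmul, hΦ, LinearMap.id_apply] at this
    simp only [Φ, map_tmul, LinearMap.comp_apply, LinearEquiv.coe_coe, LinearMap.id_apply,
      AlgHom.toLinearMap_apply, hg, tmul_smul, smul_tmul', ← sum_tmul, hgΛ] at this
    rw [← this, ← hgΛ h, map_sum]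
    simp only [map_smul]
    rfl
  · change counitₗ k H (g 1) = 1
    rw [← hgΛ (one_mul 1), ← hone]
    conv_rhs => rw [← sum_counit_smul_basis (k := k) 1 Λ]
    simp [mul_comm]
  · rw [IsRightIntegral.eq_smul hΛ hlam hone hrho b,
      IsRightIntegral.eq_smul hΛ hlam hone hrho (a * b), map_smul_right]
    simp only [LinearMap.smul_apply, map_smul, smul_assoc]
    exact congrArg (rho 1 Λ • ·) (hg rfl x)

end Integral

end HopfGCoalgebra

/-- Lemma 4.1: a finite dimensional Hopf `π`-coalgebra has a unique distinguished
`π`-grouplike element `g` with `(id ⊗ λ_β) ∘ Δ_{α,β} = λ_{αβ}(·) g_α` for every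
right `π`-integral `λ`. -/
theorem distinguished_grouplike_exists_unique (k : Type*) [Field k] {π : Type*} [Group π]
    (H : π → Type*) [∀ α, Ring (H α)] [∀ α, Algebra k (H α)] [HopfGCoalgebra k H]
    [∀ α, FiniteDimensional k (H α)] :
    ∃! g : ∀ α : π, H α, IsDistinguishedGrouplike k H g := by
  obtain ⟨Λ, lam, hΛ, hlam, hone⟩ := exists_integrals k H
  obtain ⟨g, hg⟩ := exists_distinguished hΛ hlam hone
  refine ⟨g, .of_integrals hΛ hlam hone hg, fun g₂ hg₂ => funext fun a => ?_⟩
  have h₁ := hg (mul_inv_cancel a) Λ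
  have h₂ : ∀ {c : π} (h : a * a⁻¹ = c) (x : H c), TensorProduct.rid k (H a)
      (TensorProduct.map LinearMap.id (lam a⁻¹) (comulOf k H h x)) = lam c x • g₂ a := by
    rintro c rfl x
    exact hg₂.2 lam hlam a a⁻¹ x
  rw [h₂, hone, one_smul, one_smul] at h₁
  exact h₁
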